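/- arXiv:1707.03446 — 2 statements merged into one kernel-verified Lean document; each statement's English description precedes it below -/
import Mathlib

section
/- Let n ≥ 1 and let f : ℝ → ℝ be differentiable, antitone (monotonically decreasing), and satisfy f(s) ≤ 1 for all s. For t ∈ [0,1] define the vector field Y_t on EuclideanSpace ℝ (Fin n) by Y_t(q) = ½·(1 − t·f(‖q‖²) − t·f'(‖q‖²)·‖q‖²) • q. Then for every q and every t ∈ [0,1], Y_t(q) = 0 if and only if q = 0, or t = 1 and f(‖q‖²) = 1. -/
/-- Zero-locus computation in Lemma 3.6: for `f` differentiable, antitone, bounded above by 1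
and `t ∈ [0,1]`, the vector field `Y_t(q) = ½(1 − t·f(‖q‖²) − t·f'(‖q‖²)·‖q‖²) • q`
vanishes at `q` iff `q = 0`, or `t = 1` and `f(‖q‖²) = 1`. -/
theorem stmt1 (n : ℕ) (hn : 1 ≤ n) (f : ℝ → ℝ) (hf : Differentiable ℝ f)
    (hanti : Antitone f) (hle : ∀ s : ℝ, f s ≤ 1) (t : ℝ) (ht : t ∈ Set.Icc (0 : ℝ) 1)
    (Y : EuclideanSpace ℝ (Fin n) → EuclideanSpace ℝ (Fin n))
    (hY : ∀ q : EuclideanSpace ℝ (Fin n),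
      Y q = ((1 / 2) * (1 - t * f (‖q‖ ^ 2) - t * deriv f (‖q‖ ^ 2) * ‖q‖ ^ 2)) • q)
    (q : EuclideanSpace ℝ (Fin n)) :
    Y q = 0 ↔ q = 0 ∨ (t = 1 ∧ f (‖q‖ ^ 2) = 1) := by
  obtain ⟨ht0, ht1⟩ := ht
  rw [hY, smul_eq_zero, or_comm]
  refine or_congr_right ⟨fun h => ?_, ?_⟩
  · have hderiv : deriv f (‖q‖ ^ 2) ≤ 0 := hanti.deriv_nonpos
    have hprod : t * deriv f (‖q‖ ^ 2) * ‖q‖ ^ 2 ≤ 0 :=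
      mul_nonpos_of_nonpos_of_nonneg (mul_nonpos_of_nonneg_of_nonpos ht0 hderiv) (sq_nonneg _)
    have hmul : t * f (‖q‖ ^ 2) ≤ t := mul_le_of_le_one_right ht0 (hle _)
    obtain rfl : t = 1 := by linarith
    exact ⟨rfl, by linarith⟩
  · rintro ⟨rfl, hmax⟩
    have hderiv : deriv f (‖q‖ ^ 2) = 0 :=
      IsLocalMax.deriv_eq_zero (Filter.Eventually.of_forall fun s => hmax ▸ hle s)
    simp [hmax, hderiv]
end

section
/- Let V : ℝ × ℝ → ℝ × ℝ be a continuously differentiable (C¹) vector field with components V = (V₁, V₂) in coordinates (q,p), satisfying the Liouville divergence identity ∂V₁/∂q + ∂V₂/∂p = 1 everywhere and vanishing on the q-axis: V(q,0) = 0 for all q. Then for every q₀ ∈ ℝ there exists δ > 0 such that for every T > 0 and every solution γ : [0,T] → ℝ × ℝ of γ'(t) = V(γ(t)) that remains in the closed ball of radius δ around (q₀, 0), the p-component γ₂ satisfies γ₂(t)² ≥ γ₂(0)²·exp(t) for all t ∈ [0,T]. Consequently any point of that ball lying in the set of points whose forward flow converges to the q-axis while remaining in the ball must have p = 0. -/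
/-- A divergence-one field vanishing on the `q`-axis has `∂V₂/∂p = 1` along the axis. -/
theorem fderiv_snd_eq_one_of_vanishes_on_axis {V : ℝ × ℝ → ℝ × ℝ} (hV : Differentiable ℝ V)
    (hdiv : ∀ x : ℝ × ℝ, (fderiv ℝ V x (1, 0)).1 + (fderiv ℝ V x (0, 1)).2 = 1)
    (hzero : ∀ q : ℝ, V (q, 0) = 0) (q : ℝ) : (fderiv ℝ V (q, 0) (0, 1)).2 = 1 := by
  have hline : HasDerivAt (fun s : ℝ => ((s, 0) : ℝ × ℝ)) (1, 0) q :=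
    (hasDerivAt_id q).prodMk (hasDerivAt_const q 0)
  have hcomp := (hV (q, 0)).hasFDerivAt.comp_hasDerivAt q hline
  have hconst : V ∘ (fun s : ℝ => ((s, 0) : ℝ × ℝ)) = fun _ => 0 := funext hzero
  rw [hconst] at hcomp
  have h0 : fderiv ℝ V (q, 0) (1, 0) = 0 := hcomp.unique (hasDerivAt_const q 0)
  simpa [h0] using hdiv (q, 0)

/-- If `∂V₂/∂p ≥ 1/2` on a closed ball centred on the `q`-axis, where `V` vanishes, then
`p² ≤ 2 V₂ p` on that ball. -/
theorem sq_snd_le_of_half_le_fderiv {V : ℝ × ℝ → ℝ × ℝ} (hV : Differentiable ℝ V)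
    (hzero : ∀ q : ℝ, V (q, 0) = 0) {q₀ δ : ℝ}
    (hder : ∀ x ∈ Metric.closedBall ((q₀, 0) : ℝ × ℝ) δ, 1 / 2 ≤ (fderiv ℝ V x (0, 1)).2)
    {x : ℝ × ℝ} (hx : x ∈ Metric.closedBall ((q₀, 0) : ℝ × ℝ) δ) :
    x.2 ^ 2 ≤ 2 * (V x).2 * x.2 := by
  obtain ⟨q, p⟩ := x
  rw [← closedBall_prod_same, Set.mem_prod] at hx
  obtain ⟨hq, hp⟩ := hx
  have hδ : 0 ≤ δ := dist_nonneg.trans hp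
  have hd : ∀ s : ℝ, HasDerivAt (fun s => (V (q, s)).2 - s / 2)
      ((fderiv ℝ V (q, s) (0, 1)).2 - 1 / 2) s := fun s => by
    have hline : HasDerivAt (fun s : ℝ => ((q, s) : ℝ × ℝ)) (0, 1) s :=
      (hasDerivAt_const s q).prodMk (hasDerivAt_id s)
    have hcomp : HasDerivAt (fun s => V (q, s)) (fderiv ℝ V (q, s) (0, 1)) s :=
      (hV (q, s)).hasFDerivAt.comp_hasDerivAt s hline
    have hsnd : HasDerivAt (fun s => (V (q, s)).2) (fderiv ℝ V (q, s) (0, 1)).2 s := hcomp.snd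
    exact hsnd.fun_sub ((hasDerivAt_id s).div_const 2)
  have hmono : MonotoneOn (fun s => (V (q, s)).2 - s / 2) (Metric.closedBall (0 : ℝ) δ) := by
    refine monotoneOn_of_hasDerivWithinAt_nonneg (convex_closedBall 0 δ)
      (fun s _ => (hd s).continuousAt.continuousWithinAt)
      (fun s _ => (hd s).hasDerivWithinAt) fun s hs => ?_
    refine sub_nonneg.2 (hder (q, s) ?_)
    rw [← closedBall_prod_same]
    exact ⟨hq, interior_subset hs⟩
  have h0 : (0 : ℝ) ∈ Metric.closedBall (0 : ℝ) δ := Metric.mem_closedBall_self hδ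
  rcases le_total 0 p with h | h
  · have := hmono h0 hp h
    simp only [hzero, Prod.snd_zero] at this
    nlinarith
  · have := hmono hp h0 h
    simp only [hzero, Prod.snd_zero] at this
    nlinarith

/-- If `u² ≤ 2 u' u` on `[0, T]`, then `u²` grows at least like `exp`. -/
theorem sq_mul_exp_le_sq_of_sq_le_deriv {u u' : ℝ → ℝ} {T : ℝ}
    (hu : ∀ t ∈ Set.Icc 0 T, HasDerivWithinAt u (u' t) (Set.Icc 0 T) t)
    (hle : ∀ t ∈ Set.Icc 0 T, u t ^ 2 ≤ 2 * u' t * u t) {t : ℝ} (ht : t ∈ Set.Icc 0 T) :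
    u 0 ^ 2 * Real.exp t ≤ u t ^ 2 := by
  have hd : ∀ s ∈ Set.Icc 0 T, HasDerivWithinAt (fun s => u s ^ 2 * Real.exp (-s))
      ((2 * u' s * u s - u s ^ 2) * Real.exp (-s)) (Set.Icc 0 T) s := fun s hs => by
    have hexp := (hasDerivAt_neg s).exp.hasDerivWithinAt (s := Set.Icc 0 T)
    refine (((hu s hs).fun_pow 2).fun_mul hexp).congr_deriv ?_
    push_cast
    ring
  have hmono : MonotoneOn (fun s => u s ^ 2 * Real.exp (-s)) (Set.Icc 0 T) :=
    monotoneOn_of_hasDerivWithinAt_nonneg (convex_Icc 0 T)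
      (fun s hs => (hd s hs).continuousWithinAt)
      (fun s hs => (hd s (interior_subset hs)).mono interior_subset)
      fun s hs => mul_nonneg (sub_nonneg.2 (hle s (interior_subset hs))) (Real.exp_pos _).le
  have h := hmono (Set.left_mem_Icc.2 (ht.1.trans ht.2)) ht ht.1
  simp only [neg_zero, Real.exp_zero, mul_one, Real.exp_neg] at h
  rwa [← div_eq_mul_inv, le_div_iff₀ (Real.exp_pos t)] at h


/-- Conclusion of the coordinate argument in Proposition 2.2: for a C¹ Liouville vector
field `V = (V₁,V₂)` on `ℝ²` (divergence identity `∂V₁/∂q + ∂V₂/∂p = 1`) vanishing on the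
`q`-axis, around every point `(q₀,0)` there is a closed ball of some radius `δ > 0` in which
every solution of `γ' = V ∘ γ` satisfies `γ₂(t)² ≥ γ₂(0)²·exp(t)`, and consequently every
point of the ball whose forward flow stays in the ball and converges to the `q`-axis
has `p = 0`. -/
theorem stmt5 (V : ℝ × ℝ → ℝ × ℝ) (hV : ContDiff ℝ 1 V)
    (hdiv : ∀ x : ℝ × ℝ, (fderiv ℝ V x (1, 0)).1 + (fderiv ℝ V x (0, 1)).2 = 1)
    (hzero : ∀ q : ℝ, V (q, 0) = 0) :
    ∀ q₀ : ℝ, ∃ δ > (0 : ℝ),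
      (∀ T > (0 : ℝ), ∀ γ : ℝ → ℝ × ℝ,
        (∀ t ∈ Set.Icc (0 : ℝ) T, HasDerivWithinAt γ (V (γ t)) (Set.Icc 0 T) t) →
        (∀ t ∈ Set.Icc (0 : ℝ) T, γ t ∈ Metric.closedBall ((q₀, 0) : ℝ × ℝ) δ) →
        ∀ t ∈ Set.Icc (0 : ℝ) T, (γ 0).2 ^ 2 * Real.exp t ≤ (γ t).2 ^ 2) ∧
      (∀ x ∈ Metric.closedBall ((q₀, 0) : ℝ × ℝ) δ,
        (∃ γ : ℝ → ℝ × ℝ, γ 0 = x ∧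
          (∀ t ∈ Set.Ici (0 : ℝ), HasDerivWithinAt γ (V (γ t)) (Set.Ici 0) t) ∧
          (∀ t ∈ Set.Ici (0 : ℝ), γ t ∈ Metric.closedBall ((q₀, 0) : ℝ × ℝ) δ) ∧
          Filter.Tendsto (fun t => (γ t).2) Filter.atTop (nhds 0)) →
        x.2 = 0) := by
  intro q₀
  have hdiff : Differentiable ℝ V := hV.differentiable one_ne_zero
  have hcont : Continuous fun x => (fderiv ℝ V x (0, 1)).2 :=
    ((hV.continuous_fderiv one_ne_zero).clm_apply continuous_const).snd
  have hnear : ∀ᶠ x in nhds ((q₀, 0) : ℝ × ℝ), 1 / 2 ≤ (fderiv ℝ V x (0, 1)).2 := by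
    refine hcont.continuousAt.eventually_const_le ?_
    beta_reduce
    rw [fderiv_snd_eq_one_of_vanishes_on_axis hdiff hdiv hzero]
    norm_num
  obtain ⟨δ, hδ, hball⟩ := Metric.nhds_basis_closedBall.eventually_iff.1 hnear
  have hgrowth : ∀ T > (0 : ℝ), ∀ γ : ℝ → ℝ × ℝ,
      (∀ t ∈ Set.Icc (0 : ℝ) T, HasDerivWithinAt γ (V (γ t)) (Set.Icc 0 T) t) →
      (∀ t ∈ Set.Icc (0 : ℝ) T, γ t ∈ Metric.closedBall ((q₀, 0) : ℝ × ℝ) δ) →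
      ∀ t ∈ Set.Icc (0 : ℝ) T, (γ 0).2 ^ 2 * Real.exp t ≤ (γ t).2 ^ 2 :=
    fun T _ γ hγ hmem t ht =>
      sq_mul_exp_le_sq_of_sq_le_deriv (u := fun s => (γ s).2) (fun s hs => (hγ s hs).snd)
        (fun s hs => sq_snd_le_of_half_le_fderiv hdiff hzero (fun _ hx => hball hx) (hmem s hs)) ht
  refine ⟨δ, hδ, hgrowth, ?_⟩
  rintro x - ⟨γ, rfl, hγ, hmem, hlim⟩
  have hle : ∀ᶠ T in Filter.atTop, (γ 0).2 ^ 2 ≤ (γ T).2 ^ 2 := by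
    filter_upwards [Filter.eventually_gt_atTop (0 : ℝ)] with T hT
    have h := hgrowth T hT γ (fun t ht => (hγ t ht.1).mono Set.Icc_subset_Ici_self)
      (fun t ht => hmem t ht.1) T (Set.right_mem_Icc.2 hT.le)
    exact (le_mul_of_one_le_right (sq_nonneg _) (Real.one_le_exp hT.le)).trans h
  have h0 : (γ 0).2 ^ 2 ≤ 0 ^ 2 := ge_of_tendsto (hlim.pow 2) hle
  exact pow_eq_zero_iff two_ne_zero |>.1 (le_antisymm (by simpa using h0) (sq_nonneg _))
end
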